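/- arXiv:2204.11038 — 5 statements merged into one kernel-verified Lean document; each statement's English description precedes it below -/
import Mathlib

section
/- Suppose ♦ ≥ 0 and ♦_g ≥ 0 satisfy |∫_U e^{F(u)} du − ∫_U e^{−‖D_G u‖²/2} du| ≤ ♦·Z and |∫_U g(u) e^{F(u)} du − ∫_U g(u) e^{−‖D_G u‖²/2} du| ≤ ♦_g·Z, and that ρ_G + ♦ < 1. Then (∫_{ℝ^p} g(u) e^{F(u)} du)/(∫_{ℝ^p} e^{F(u)} du) ≤ (1 − ρ_G − ♦)⁻¹ · Z⁻¹ ∫_{ℝ^p} g(u) e^{−‖D_G u‖²/2} du + (ρ + ♦_g)/(1 − ρ_G − ♦), and (∫_{ℝ^p} g(u) e^{F(u)} du)/(∫_{ℝ^p} e^{F(u)} du) ≥ (1 + ρ + ♦)⁻¹ · Z⁻¹ ∫_{ℝ^p} g(u) e^{−‖D_G u‖²/2} du − (ρ_G + ♦_g)/(1 + ρ + ♦). -/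
open MeasureTheory Real

/-- `gaussNorm D u = ‖D u‖`, the Euclidean norm of the matrix `D` applied to `u`. -/
noncomputable def gaussNorm {p : ℕ} (D : Matrix (Fin p) (Fin p) ℝ)
    (u : EuclideanSpace ℝ (Fin p)) : ℝ :=
  ‖(Matrix.toEuclideanLin D) u‖

theorem gauss_integrable (p : ℕ) (D : Matrix (Fin p) (Fin p) ℝ) (hD : D.PosDef) :
    Integrable (fun u : EuclideanSpace ℝ (Fin p) => exp (-(gaussNorm D u) ^ 2 / 2)) := by
  have hker : LinearMap.ker (Matrix.toEuclideanLin D) = ⊥ := by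
    rw [LinearMap.ker_eq_bot']
    intro u hu
    have hz : D.mulVec u.ofLp = 0 := by
      have := congrArg WithLp.ofLp hu
      simpa [Matrix.toEuclideanLin] using this
    have hinj := Matrix.mulVec_injective_of_isUnit hD.isUnit
    have : u.ofLp = 0 := hinj (by simpa using hz)
    ext i
    simpa using congrFun this i
  obtain ⟨K, hK, hA⟩ := LinearMap.exists_antilipschitzWith (Matrix.toEuclideanLin D) hker
  have hb : ∀ u, ‖u‖ ≤ K * ‖Matrix.toEuclideanLin D u‖ := fun u => by
    have := hA.le_mul_dist u 0
    simpa [dist_eq_norm] using this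
  have hK' : (0 : ℝ) < K := by exact_mod_cast hK
  have hcont : Continuous (Matrix.toEuclideanLin D) :=
    LinearMap.continuous_of_finiteDimensional _
  have hc : 0 < ((2 * (K : ℝ) ^ 2)⁻¹) := by positivity
  have hI : Integrable (fun u : EuclideanSpace ℝ (Fin p) =>
      exp (-((2 * (K : ℝ) ^ 2)⁻¹) * ‖u‖ ^ 2)) := by
    have h := GaussianFourier.integrable_cexp_neg_mul_sq_norm_add
      (V := EuclideanSpace ℝ (Fin p)) (b := (((2 * (K : ℝ) ^ 2)⁻¹ : ℝ) : ℂ))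
      (by rw [Complex.ofReal_re]; exact hc) 0 0
    refine h.norm.congr (Filter.Eventually.of_forall fun u => ?_)
    simp only [Complex.norm_exp]
    congr 1
    simp only [inner_zero_left, Complex.ofReal_zero, mul_zero, add_zero]
    norm_cast
  refine hI.mono' ?_ (Filter.Eventually.of_forall fun u => ?_)
  · unfold gaussNorm
    exact Continuous.aestronglyMeasurable (by fun_prop)
  · rw [Real.norm_eq_abs, abs_of_pos (exp_pos _)]
    apply exp_le_exp.2
    have h := hb u
    have h2 : ‖u‖ ^ 2 ≤ (K * ‖Matrix.toEuclideanLin D u‖) ^ 2 :=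
      pow_le_pow_left₀ (norm_nonneg _) h 2
    unfold gaussNorm
    have h3 : (2 * (K : ℝ) ^ 2)⁻¹ * ‖u‖ ^ 2 ≤
        (2 * (K : ℝ) ^ 2)⁻¹ * (K * ‖Matrix.toEuclideanLin D u‖) ^ 2 :=
      mul_le_mul_of_nonneg_left h2 hc.le
    have h4 : (2 * (K : ℝ) ^ 2)⁻¹ * (K * ‖Matrix.toEuclideanLin D u‖) ^ 2 =
        ‖Matrix.toEuclideanLin D u‖ ^ 2 / 2 := by
      field_simp
    linarith

theorem stmt_0 (p : ℕ)
    (DG : Matrix (Fin p) (Fin p) ℝ) (hDG : DG.PosDef)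
    (F : EuclideanSpace ℝ (Fin p) → ℝ) (hFmeas : Measurable F)
    (hFint : Integrable (fun u => exp (F u)))
    (U : Set (EuclideanSpace ℝ (Fin p))) (hU : MeasurableSet U)
    (g : EuclideanSpace ℝ (Fin p) → ℝ) (hgmeas : Measurable g)
    (hg : ∀ u, 0 ≤ g u ∧ g u ≤ 1)
    (Z ρ ρG dia diag : ℝ)
    (hZ : Z = ∫ u, exp (-(gaussNorm DG u) ^ 2 / 2))
    (hρ : ρ = Z⁻¹ * ∫ u in Uᶜ, exp (F u))
    (hρG : ρG = Z⁻¹ * ∫ u in Uᶜ, exp (-(gaussNorm DG u) ^ 2 / 2))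
    (hdia : 0 ≤ dia) (hdiag : 0 ≤ diag)
    (h1 : |(∫ u in U, exp (F u)) - ∫ u in U, exp (-(gaussNorm DG u) ^ 2 / 2)| ≤ dia * Z)
    (h2 : |(∫ u in U, g u * exp (F u)) -
        ∫ u in U, g u * exp (-(gaussNorm DG u) ^ 2 / 2)| ≤ diag * Z)
    (hlt : ρG + dia < 1) :
    (∫ u, g u * exp (F u)) / (∫ u, exp (F u)) ≤
        (1 - ρG - dia)⁻¹ * (Z⁻¹ * ∫ u, g u * exp (-(gaussNorm DG u) ^ 2 / 2))
          + (ρ + diag) / (1 - ρG - dia)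
      ∧ (∫ u, g u * exp (F u)) / (∫ u, exp (F u)) ≥
        (1 + ρ + dia)⁻¹ * (Z⁻¹ * ∫ u, g u * exp (-(gaussNorm DG u) ^ 2 / 2))
          - (ρG + diag) / (1 + ρ + dia) := by
  have hG := gauss_integrable p DG hDG
  have hZpos : 0 < Z := by
    rw [hZ]
    exact integral_exp_pos hG
  have hmul : ∀ f : EuclideanSpace ℝ (Fin p) → ℝ, Integrable f → (∀ u, 0 ≤ f u) →
      Integrable (fun u => g u * f u) := by
    intro f hf h0
    refine hf.mono' (hgmeas.aestronglyMeasurable.mul hf.1)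
      (Filter.Eventually.of_forall fun u => ?_)
    rw [Real.norm_eq_abs, abs_of_nonneg (mul_nonneg (hg u).1 (h0 u))]
    exact mul_le_of_le_one_left (h0 u) (hg u).2
  have key : ∀ f : EuclideanSpace ℝ (Fin p) → ℝ, Integrable f → (∀ u, 0 ≤ f u) →
      ((∫ u in U, f u) + ∫ u in Uᶜ, f u) = (∫ u, f u) ∧
      ((∫ u in U, g u * f u) + ∫ u in Uᶜ, g u * f u) = (∫ u, g u * f u) ∧
      0 ≤ (∫ u in Uᶜ, g u * f u) ∧ (∫ u in Uᶜ, g u * f u) ≤ (∫ u in Uᶜ, f u) ∧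
      0 ≤ ∫ u, g u * f u := by
    intro f hf h0
    have hgf := hmul f hf h0
    exact ⟨integral_add_compl hU hf, integral_add_compl hU hgf,
      integral_nonneg fun u => mul_nonneg (hg u).1 (h0 u),
      integral_mono hgf.integrableOn hf.integrableOn
        fun u => mul_le_of_le_one_left (h0 u) (hg u).2,
      integral_nonneg fun u => mul_nonneg (hg u).1 (h0 u)⟩
  obtain ⟨a1, a2, a3, a4, a5⟩ := key _ hFint fun u => (exp_pos _).le
  obtain ⟨b1, b2, b3, b4, b5⟩ := key _ hG fun u => (exp_pos _).le
  rw [← hZ] at b1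
  have hρ' : (∫ u in Uᶜ, exp (F u)) = ρ * Z := by rw [hρ]; field_simp
  have hρG' : (∫ u in Uᶜ, exp (-(gaussNorm DG u) ^ 2 / 2)) = ρG * Z := by rw [hρG]; field_simp
  rw [hρ'] at a1 a4
  rw [hρG'] at b1 b4
  clear hρ hρG hρ' hρG' key hmul
  generalize (∫ u, g u * exp (F u)) = NF at *
  generalize (∫ u, exp (F u)) = DF at *
  generalize (∫ u, g u * exp (-(gaussNorm DG u) ^ 2 / 2)) = NG at *
  generalize (∫ u in U, g u * exp (F u)) = x1 at *
  generalize (∫ u in U, g u * exp (-(gaussNorm DG u) ^ 2 / 2)) = x2 at *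
  generalize (∫ u in Uᶜ, g u * exp (F u)) = x3 at *
  generalize (∫ u in Uᶜ, g u * exp (-(gaussNorm DG u) ^ 2 / 2)) = x4 at *
  generalize (∫ u in U, exp (F u)) = x5 at *
  generalize (∫ u in U, exp (-(gaussNorm DG u) ^ 2 / 2)) = x6 at *
  rw [abs_le] at h1 h2
  have hρ0 : 0 ≤ ρ := nonneg_of_mul_nonneg_left (a3.trans a4) hZpos
  have hA : 0 < 1 - ρG - dia := by linarith
  have hB : 0 < 1 + ρ + dia := by linarith
  have hρG0 : 0 ≤ ρG := nonneg_of_mul_nonneg_left (b3.trans b4) hZpos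
  have hDlo : (1 - ρG - dia) * Z ≤ DF := by nlinarith
  have hDhi : DF ≤ (1 + ρ + dia) * Z := by nlinarith
  have hAZ : 0 < (1 - ρG - dia) * Z := mul_pos hA hZpos
  have hDpos : 0 < DF := by linarith
  constructor
  · have e : (1 - ρG - dia)⁻¹ * (Z⁻¹ * NG) + (ρ + diag) / (1 - ρG - dia)
        = (NG + (ρ + diag) * Z) / ((1 - ρG - dia) * Z) := by field_simp
    rw [e]
    exact div_le_div₀ (by nlinarith) (by nlinarith) hAZ hDlo
  · have e : (1 + ρ + dia)⁻¹ * (Z⁻¹ * NG) - (ρG + diag) / (1 + ρ + dia)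
        = (NG - (ρG + diag) * Z) / ((1 + ρ + dia) * Z) := by field_simp
    rw [e, ge_iff_le]
    calc _ ≤ NF / ((1 + ρ + dia) * Z) :=
          div_le_div_of_nonneg_right (by nlinarith) (by positivity)
      _ ≤ NF / DF := div_le_div_of_nonneg_left a5 hDpos hDhi
end

section
/- If sup_{|u| ≤ z} |δ₃(u)|/(D²u²/2) ≤ ω for some ω ≤ 1/3, then for every measurable g : ℝ → ℝ with |g(u)| ≤ 1 for all u, |∫_{−z}^{z} e^{f(x;u)} g(u) du − ∫_{−z}^{z} e^{−D²u²/2} g(u) du| ≤ (ω/(2(1−ω))) · ∫_{ℝ} e^{−D²u²/2} du. -/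
open MeasureTheory Real

theorem stmt_3 (f : ℝ → ℝ) (hf : ContDiff ℝ 2 f) (x : ℝ) (D : ℝ) (hD : 0 < D)
    (hf'' : deriv (deriv f) x = -D ^ 2) (z : ℝ) (hz : 0 < z) (ω : ℝ) (hω : ω ≤ 1 / 3)
    (hδ : ∀ u : ℝ, |u| ≤ z →
      |f (x + u) - f x - deriv f x * u + D ^ 2 * u ^ 2 / 2| ≤ ω * (D ^ 2 * u ^ 2 / 2))
    (g : ℝ → ℝ) (hgmeas : Measurable g) (hg : ∀ u, |g u| ≤ 1) :
    |(∫ u in (-z)..z, exp (f (x + u) - f x - deriv f x * u) * g u) -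
        ∫ u in (-z)..z, exp (-(D ^ 2 * u ^ 2) / 2) * g u| ≤
      ω / (2 * (1 - ω)) * ∫ u : ℝ, exp (-(D ^ 2 * u ^ 2) / 2) := by
  have hω0 : 0 ≤ ω := by
    have h := (abs_nonneg _).trans (hδ z (by rw [abs_of_pos hz]))
    by_contra hneg
    push Not at hneg
    have : 0 < D ^ 2 * z ^ 2 / 2 := by positivity
    nlinarith
  have hω1 : 0 < 1 - ω := by linarith
  have hb : 0 < D ^ 2 / 2 := by positivity
  have hb' : 0 < (1 - ω) * (D ^ 2 / 2) := by positivity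
  have hcf : Continuous f := hf.continuous
  have hgi : ∀ h : ℝ → ℝ, Continuous h →
      IntervalIntegrable (fun u => h u * g u) volume (-z) z := by
    intro h hh
    have h1 : IntervalIntegrable h volume (-z) z := hh.intervalIntegrable _ _
    refine h1.mono_fun (hh.measurable.mul hgmeas).aestronglyMeasurable ?_
    refine Filter.Eventually.of_forall fun u => ?_
    simp only [norm_mul, Real.norm_eq_abs]
    exact mul_le_of_le_one_right (abs_nonneg _) (hg u)
  rw [← intervalIntegral.integral_sub (hgi _ (by fun_prop)) (hgi _ (by fun_prop))]
  have e1 : ∀ u : ℝ, -(D ^ 2 * u ^ 2) / 2 = -(D ^ 2 / 2) * u ^ 2 := fun u => by ring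
  simp only [e1]
  set G : ℝ → ℝ := fun u => exp (-((1 - ω) * (D ^ 2 / 2)) * u ^ 2) - exp (-(D ^ 2 / 2) * u ^ 2)
    with hG
  have i1 := integrable_exp_neg_mul_sq hb
  have i2 := integrable_exp_neg_mul_sq hb'
  have iG : Integrable G := i2.sub i1
  have hG0 : ∀ u, 0 ≤ G u := by
    intro u
    simp only [hG, sub_nonneg]
    apply exp_le_exp.2
    have : 0 ≤ ω * ((D ^ 2 / 2) * u ^ 2) := by positivity
    nlinarith
  have step1 : |∫ u in (-z)..z, (exp (f (x + u) - f x - deriv f x * u) * g u -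
      exp (-(D ^ 2 / 2) * u ^ 2) * g u)| ≤ ∫ u in (-z)..z, G u := by
    rw [← Real.norm_eq_abs]
    refine intervalIntegral.norm_integral_le_of_norm_le (by linarith) ?_ iG.intervalIntegrable
    refine Filter.Eventually.of_forall fun u hu => ?_
    have hu' : |u| ≤ z := abs_le.2 ⟨hu.1.le, hu.2⟩
    have hd := hδ u hu'
    set d := f (x + u) - f x - deriv f x * u + D ^ 2 * u ^ 2 / 2 with hdd
    have hd' : f (x + u) - f x - deriv f x * u = -(D ^ 2 / 2) * u ^ 2 + d := by
      rw [hdd]; ring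
    have hG' : G u = exp (-(D ^ 2 / 2) * u ^ 2) * (exp (ω * (D ^ 2 * u ^ 2 / 2)) - 1) := by
      simp only [hG]
      rw [mul_sub, ← exp_add, mul_one]
      congr 2
      ring
    rw [hd', exp_add, hG', Real.norm_eq_abs]
    set a := ω * (D ^ 2 * u ^ 2 / 2)
    set E := exp (-(D ^ 2 / 2) * u ^ 2) with hE
    have hE0 : 0 < E := exp_pos _
    have key : |exp d - 1| ≤ exp a - 1 := by
      have := exp_le_exp.2 (abs_le.1 hd).1
      have := exp_le_exp.2 (abs_le.1 hd).2
      have := add_one_le_exp a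
      have := add_one_le_exp (-a)
      have h2 : exp a * exp (-a) = 1 := by rw [← exp_add]; simp
      have h3 := exp_pos a
      have h4 := exp_pos (-a)
      rw [abs_le]
      constructor <;> linarith
    have : E * exp d * g u - E * g u = E * ((exp d - 1) * g u) := by ring
    rw [this, abs_mul, abs_mul, abs_of_pos hE0]
    refine mul_le_mul_of_nonneg_left ?_ hE0.le
    exact (mul_le_of_le_one_right (abs_nonneg _) (hg u)).trans key
  refine step1.trans ?_
  have step2 : ∫ u in (-z)..z, G u ≤ ∫ u, G u := by
    rw [intervalIntegral.integral_of_le (by linarith)]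
    exact setIntegral_le_integral iG (Filter.Eventually.of_forall hG0)
  refine step2.trans ?_
  simp only [hG]
  rw [integral_sub i2 i1, integral_gaussian, integral_gaussian]
  have e2 : π / ((1 - ω) * (D ^ 2 / 2)) = (π / (D ^ 2 / 2)) / (1 - ω) := by
    field_simp
  rw [e2, Real.sqrt_div (by positivity)]
  set C := √(π / (D ^ 2 / 2))
  have hC : 0 ≤ C := Real.sqrt_nonneg _
  have hs : 0 < √(1 - ω) := Real.sqrt_pos.2 hω1
  have hss : √(1 - ω) ^ 2 = 1 - ω := Real.sq_sqrt hω1.le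
  set s := √(1 - ω)
  have hωs : ω = 1 - s ^ 2 := by linarith
  have e3 : ω / (2 * (1 - ω)) * C - (C / s - C) = C * (1 - s) ^ 2 / (2 * s ^ 2) := by
    rw [← hss, hωs]
    field_simp
    ring
  have : 0 ≤ C * (1 - s) ^ 2 / (2 * s ^ 2) := by positivity
  linarith
end

section
/- If sup_{|u| ≤ z} |δ₃(u)|/(D²u²/2) ≤ ω for some ω ≤ 1/3, and in addition there is a constant c₃ ≥ 0 such that |δ₃(u)| ≤ c₃|u|³/6 for all |u| ≤ z, then for every measurable g : ℝ → ℝ with |g(u)| ≤ 1 for all u, |∫_{−z}^{z} e^{f(x;u)} g(u) du − ∫_{−z}^{z} e^{−D²u²/2} g(u) du| ≤ (0.7·c₃/D³) · ∫_{ℝ} e^{−D²u²/2} du. -/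
open MeasureTheory Real

lemma aux_exp (t : ℝ) : |exp t - 1| ≤ |t| * exp |t| := by
  rcases le_total 0 t with h | h
  · rw [abs_of_nonneg h, abs_of_nonneg (by linarith [add_one_le_exp t])]
    have h1 := add_one_le_exp (-t)
    have h2 : exp (-t) * exp t = 1 := by rw [← exp_add]; simp
    nlinarith [exp_pos t]
  · rw [abs_of_nonpos h, abs_of_nonpos (by linarith [exp_le_one_iff.mpr h])]
    have h1 := add_one_le_exp t
    have h3 : 1 ≤ exp (-t) := one_le_exp (by linarith)
    nlinarith

lemma aux_int (a z : ℝ) (ha : 0 < a) (hz : 0 < z) :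
    ∫ u in (-z)..z, |u| ^ 3 * exp (-(a * u ^ 2)) ≤ 1 / a ^ 2 := by
  have hc : Continuous fun u : ℝ => |u| ^ 3 * exp (-(a * u ^ 2)) := by fun_prop
  have key : ∫ u in (0:ℝ)..z, |u| ^ 3 * exp (-(a * u ^ 2)) ≤ 1 / (2 * a ^ 2) := by
    have h1 : ∫ u in (0:ℝ)..z, |u| ^ 3 * exp (-(a * u ^ 2))
        = ∫ u in (0:ℝ)..z, u ^ 3 * exp (-(a * u ^ 2)) := by
      apply intervalIntegral.integral_congr
      intro u hu
      rw [Set.uIcc_of_le hz.le] at hu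
      simp only [abs_of_nonneg hu.1]
    have h2 : ∫ u in (0:ℝ)..z, u ^ 3 * exp (-(a * u ^ 2))
        = (-(a * z ^ 2 + 1) / (2 * a ^ 2) * exp (-(a * z ^ 2)))
          - (-(a * 0 ^ 2 + 1) / (2 * a ^ 2) * exp (-(a * 0 ^ 2))) := by
      apply intervalIntegral.integral_eq_sub_of_hasDerivAt
        (f := fun u => -(a * u ^ 2 + 1) / (2 * a ^ 2) * exp (-(a * u ^ 2)))
      · intro u _
        have e1 : HasDerivAt (fun u : ℝ => a * u ^ 2) (a * (2 * u)) u := by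
          simpa using (hasDerivAt_pow 2 u).const_mul a
        have e2 := (((e1.add_const 1).neg).div_const (2 * a ^ 2)).mul (e1.neg.exp)
        refine e2.congr_deriv ?_
        simp
        field_simp
        ring
      · exact Continuous.intervalIntegrable (by fun_prop) _ _
    rw [h1, h2]
    have : 0 ≤ (a * z ^ 2 + 1) / (2 * a ^ 2) * exp (-(a * z ^ 2)) := by positivity
    simp only [neg_div, neg_mul] at *
    norm_num at *
    linarith
  have hneg : ∫ u in (-z)..0, |u| ^ 3 * exp (-(a * u ^ 2))
      = ∫ u in (0:ℝ)..z, |u| ^ 3 * exp (-(a * u ^ 2)) := by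
    have := intervalIntegral.integral_comp_neg (a := 0) (b := z)
      (fun u : ℝ => |u| ^ 3 * exp (-(a * u ^ 2)))
    simp at this
    exact this.symm
  rw [← intervalIntegral.integral_add_adjacent_intervals (b := 0)
    (hc.intervalIntegrable _ _) (hc.intervalIntegrable _ _), hneg]
  have : 1 / a ^ 2 = 1 / (2 * a ^ 2) + 1 / (2 * a ^ 2) := by field_simp; norm_num <;> ring
  linarith

lemma aux_ii (h g : ℝ → ℝ) (hh : Continuous h) (hgmeas : Measurable g) (hg : ∀ u, |g u| ≤ 1)
    (a b : ℝ) : IntervalIntegrable (fun u => h u * g u) volume a b := by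
  refine (hh.intervalIntegrable a b).mono_fun
    (hh.measurable.mul hgmeas).aestronglyMeasurable (Filter.Eventually.of_forall fun u => ?_)
  simp only [norm_eq_abs, abs_mul]
  exact mul_le_of_le_one_right (abs_nonneg _) (hg u)

theorem stmt_4 (f : ℝ → ℝ) (hf : ContDiff ℝ 2 f) (x : ℝ) (D : ℝ) (hD : 0 < D)
    (hf'' : deriv (deriv f) x = -D ^ 2) (z : ℝ) (hz : 0 < z) (ω : ℝ) (hω : ω ≤ 1 / 3)
    (hδ : ∀ u : ℝ, |u| ≤ z →
      |f (x + u) - f x - deriv f x * u + D ^ 2 * u ^ 2 / 2| ≤ ω * (D ^ 2 * u ^ 2 / 2))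
    (c₃ : ℝ) (hc₃ : 0 ≤ c₃)
    (hδ3 : ∀ u : ℝ, |u| ≤ z →
      |f (x + u) - f x - deriv f x * u + D ^ 2 * u ^ 2 / 2| ≤ c₃ * |u| ^ 3 / 6)
    (g : ℝ → ℝ) (hgmeas : Measurable g) (hg : ∀ u, |g u| ≤ 1) :
    |(∫ u in (-z)..z, exp (f (x + u) - f x - deriv f x * u) * g u) -
        ∫ u in (-z)..z, exp (-(D ^ 2 * u ^ 2) / 2) * g u| ≤
      0.7 * c₃ / D ^ 3 * ∫ u : ℝ, exp (-(D ^ 2 * u ^ 2) / 2) := by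
  have hfc : Continuous f := hf.continuous
  have i1 := aux_ii (fun u => exp (f (x + u) - f x - deriv f x * u)) g (by fun_prop) hgmeas hg (-z) z
  have i2 := aux_ii (fun u => exp (-(D ^ 2 * u ^ 2) / 2)) g (by fun_prop) hgmeas hg (-z) z
  rw [← intervalIntegral.integral_sub i1 i2]
  have hb : ∀ u ∈ Set.Ioc (-z) z, ‖exp (f (x + u) - f x - deriv f x * u) * g u
      - exp (-(D ^ 2 * u ^ 2) / 2) * g u‖
        ≤ c₃ / 6 * (|u| ^ 3 * exp (-(D ^ 2 / 3 * u ^ 2))) := by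
    intro u hu
    have huz : |u| ≤ z := abs_le.mpr ⟨hu.1.le, hu.2⟩
    have h1 := hδ u huz
    have h2 := hδ3 u huz
    set d := f (x + u) - f x - deriv f x * u + D ^ 2 * u ^ 2 / 2 with hd
    have e : exp (f (x + u) - f x - deriv f x * u) = exp (-(D ^ 2 * u ^ 2) / 2) * exp d := by
      rw [← exp_add, hd]; congr 1; ring
    have hd3 : |d| ≤ D ^ 2 * u ^ 2 / 6 := by nlinarith [mul_nonneg (sq_nonneg D) (sq_nonneg u)]
    rw [e, ← sub_mul, norm_eq_abs, abs_mul]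
    have e2 : exp (-(D ^ 2 * u ^ 2) / 2) * exp d - exp (-(D ^ 2 * u ^ 2) / 2)
      = exp (-(D ^ 2 * u ^ 2) / 2) * (exp d - 1) := by ring
    rw [e2, abs_mul, abs_of_pos (exp_pos _)]
    calc _ ≤ exp (-(D ^ 2 * u ^ 2) / 2) * |exp d - 1| :=
          mul_le_of_le_one_right (by positivity) (hg u)
      _ ≤ exp (-(D ^ 2 * u ^ 2) / 2) * (c₃ * |u| ^ 3 / 6 * exp (D ^ 2 * u ^ 2 / 6)) := by
          refine mul_le_mul_of_nonneg_left ((aux_exp d).trans ?_) (exp_pos _).le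
          exact mul_le_mul h2 (exp_le_exp.mpr hd3) (exp_pos _).le (by positivity)
      _ = c₃ / 6 * (|u| ^ 3 * (exp (-(D ^ 2 * u ^ 2) / 2) * exp (D ^ 2 * u ^ 2 / 6))) := by ring
      _ = _ := by
          rw [← exp_add]; congr 3; ring
  have hle := intervalIntegral.norm_integral_le_of_norm_le (μ := volume) (by linarith : -z ≤ z)
    (Filter.Eventually.of_forall hb) (Continuous.intervalIntegrable (by fun_prop) _ _)
  rw [intervalIntegral.integral_const_mul, norm_eq_abs] at hle
  have hI := aux_int (D ^ 2 / 3) z (by positivity) hz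
  have hG : ∫ u : ℝ, exp (-(D ^ 2 * u ^ 2) / 2) = √(2 * π) / D := by
    have := integral_gaussian (D ^ 2 / 2)
    have e : (fun u : ℝ => exp (-(D ^ 2 * u ^ 2) / 2)) = fun u => exp (-(D ^ 2 / 2) * u ^ 2) := by
      funext u; congr 1; ring
    rw [e, this, show π / (D ^ 2 / 2) = 2 * π / D ^ 2 by field_simp, sqrt_div (by positivity),
      sqrt_sq hD.le]
  rw [hG]
  have hs : 15 / 7 ≤ √(2 * π) := by
    apply le_sqrt_of_sq_le
    nlinarith [pi_gt_three]
  calc _ ≤ _ := hle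
    _ ≤ c₃ / 6 * (1 / (D ^ 2 / 3) ^ 2) := mul_le_mul_of_nonneg_left hI (by positivity)
    _ = 0.7 * c₃ / D ^ 3 * ((15 / 7) / D) := by field_simp; norm_num <;> ring
    _ ≤ _ := by gcongr
end

section
/- If ω·p_G ≤ 2/3, then for every measurable g : ℝ^p → ℝ with |g(u)| ≤ 1 for all u, |∫_U e^{F(u)} g(u) du − ∫_U e^{−‖D_G u‖²/2} g(u) du| ≤ (0.75·ω·p_G/(1−ω)) · Z. -/
open MeasureTheory Real Matrix

theorem gaussNorm_sq {p : ℕ} (D : Matrix (Fin p) (Fin p) ℝ) (u : EuclideanSpace ℝ (Fin p)) :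
    gaussNorm D u ^ 2 = (WithLp.ofLp u) ⬝ᵥ ((Dᵀ * D) *ᵥ (WithLp.ofLp u)) := by
  unfold gaussNorm
  rw [EuclideanSpace.real_norm_sq_eq, ← Matrix.mulVec_mulVec, Matrix.dotProduct_mulVec,
    Matrix.vecMul_transpose]
  simp [dotProduct, pow_two, Matrix.toLpLin_apply]

theorem diag_exists {p : ℕ}
    (DG DV : Matrix (Fin p) (Fin p) ℝ) (hDG : DG.PosDef) (hDV : DV.PosDef)
    (hLoewner : (DG * DG - DV * DV).PosSemidef) :
    ∃ (L : EuclideanSpace ℝ (Fin p) ≃ₗ[ℝ] EuclideanSpace ℝ (Fin p)) (b : Fin p → ℝ),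
      (∀ i, 0 ≤ b i) ∧ (∀ i, b i ≤ 1) ∧ ∑ i, b i = ((DV * DV) * (DG * DG)⁻¹).trace ∧
      (∀ y, gaussNorm DG (L y) ^ 2 = ∑ i, y i ^ 2) ∧
      (∀ y, gaussNorm DV (L y) ^ 2 = ∑ i, b i * y i ^ 2) := by
  have hGt : DGᵀ = DG := by simpa using hDG.isHermitian.eq
  have hVt : DVᵀ = DV := by simpa using hDV.isHermitian.eq
  have hGu : IsUnit DG.det := hDG.det_pos.ne'.isUnit
  have hGit : DG⁻¹ᵀ = DG⁻¹ := by rw [Matrix.transpose_nonsing_inv, hGt]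
  set B : Matrix (Fin p) (Fin p) ℝ := DG⁻¹ * (DV * DV) * DG⁻¹ with hBdef
  have hB : B.IsHermitian := by
    show Bᴴ = B
    rw [Matrix.conjTranspose_eq_transpose_of_trivial, hBdef]
    simp only [Matrix.transpose_mul, hGit, hVt, Matrix.mul_assoc]
  set e := hB.eigenvectorBasis with he
  have hinv1 : (Matrix.toEuclideanLin DG).comp (Matrix.toEuclideanLin DG⁻¹) = LinearMap.id := by
    ext x : 1
    simp [Matrix.toLpLin_apply, Matrix.mulVec_mulVec, Matrix.mul_nonsing_inv _ hGu]
  have hinv2 : (Matrix.toEuclideanLin DG⁻¹).comp (Matrix.toEuclideanLin DG) = LinearMap.id := by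
    ext x : 1
    simp [Matrix.toLpLin_apply, Matrix.mulVec_mulVec, Matrix.nonsing_inv_mul _ hGu]
  let G : EuclideanSpace ℝ (Fin p) ≃ₗ[ℝ] EuclideanSpace ℝ (Fin p) :=
    LinearEquiv.ofLinearMap (Matrix.toEuclideanLin DG⁻¹) (Matrix.toEuclideanLin DG) hinv2 hinv1
  let L := e.repr.symm.toLinearEquiv.trans G
  have hLy : ∀ y, L y = Matrix.toEuclideanLin DG⁻¹ (e.repr.symm y) := fun y => rfl
  have h1 : ∀ y, gaussNorm DG (L y) ^ 2 = ∑ i, y i ^ 2 := by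
    intro y
    unfold gaussNorm
    have : Matrix.toEuclideanLin DG (L y) = e.repr.symm y := by
      rw [hLy]; exact LinearMap.congr_fun hinv1 _
    rw [this, LinearIsometryEquiv.norm_map, EuclideanSpace.real_norm_sq_eq]
  have h2 : ∀ y, gaussNorm DV (L y) ^ 2 = ∑ i, hB.eigenvalues i * y i ^ 2 := by
    intro y
    set w := e.repr.symm y with hw
    have hy : y = e.repr w := by simp [hw]
    have hBw : ∀ i, e.repr (Matrix.toEuclideanLin B w) i = hB.eigenvalues i * y i := by
      intro i
      rw [hy, e.repr_apply_apply, e.repr_apply_apply]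
      have hs := (Matrix.isSymmetric_toEuclideanLin_iff (A := B)).2 hB
      rw [← hs]
      have : Matrix.toEuclideanLin B (e i) = hB.eigenvalues i • e i := by
        have := hB.mulVec_eigenvectorBasis i
        rw [Matrix.toLpLin_apply]
        rw [this]; rfl
      rw [this, inner_smul_left]; simp
    have : gaussNorm DV (L y) ^ 2 = inner ℝ (Matrix.toEuclideanLin B w) w := by
      rw [gaussNorm_sq, hLy, hVt, ← hw, EuclideanSpace.inner_eq_star_dotProduct]
      simp only [Matrix.toLpLin_apply, star_trivial]
      rw [hBdef, Matrix.mul_assoc DG⁻¹, ← Matrix.mulVec_mulVec _ DG⁻¹,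
        Matrix.dotProduct_mulVec _ DG⁻¹, ← Matrix.mulVec_transpose, hGit, Matrix.mulVec_mulVec]
    rw [this, ← e.repr.inner_map_map, ← hy]
    rw [PiLp.inner_apply]
    refine Finset.sum_congr rfl fun i _ => ?_
    rw [hBw]; simp; ring
  have hle : ∀ u, gaussNorm DV u ^ 2 ≤ gaussNorm DG u ^ 2 := by
    intro u
    rw [gaussNorm_sq, gaussNorm_sq, hGt, hVt]
    have := hLoewner.dotProduct_mulVec_nonneg (WithLp.ofLp u)
    rw [Matrix.sub_mulVec, dotProduct_sub] at this
    simpa using this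
  have hb : ∀ i, gaussNorm DV (L (EuclideanSpace.single i 1)) ^ 2 = hB.eigenvalues i := by
    intro i
    rw [h2]; simp
  have hb1 : ∀ i, gaussNorm DG (L (EuclideanSpace.single i 1)) ^ 2 = 1 := by
    intro i
    rw [h1]; simp
  refine ⟨L, hB.eigenvalues, fun i => ?_, fun i => ?_, ?_, h1, h2⟩
  · rw [← hb]; positivity
  · have := hle (L (EuclideanSpace.single i 1))
    rwa [hb, hb1] at this
  · have := hB.trace_eq_sum_eigenvalues
    simp only [RCLike.ofReal_real_eq_id, id] at this
    rw [← this, hBdef, Matrix.mul_inv_rev, Matrix.mul_assoc, Matrix.trace_mul_comm,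
      Matrix.mul_assoc]

/-- Product Gaussian integral. -/
theorem gauss_prod {p : ℕ} (a : Fin p → ℝ) (ha : ∀ i, 0 < a i) :
    Integrable (fun y : EuclideanSpace ℝ (Fin p) => exp (-∑ i, a i * y i ^ 2)) ∧
    ∫ y : EuclideanSpace ℝ (Fin p), exp (-∑ i, a i * y i ^ 2) = ∏ i, √(π / a i) := by
  have mp := EuclideanSpace.volume_preserving_symm_measurableEquiv_toLp (Fin p)
  have hf : (fun y : EuclideanSpace ℝ (Fin p) => exp (-∑ i, a i * y i ^ 2)) =
      (fun x : Fin p → ℝ => ∏ i, exp (-a i * x i ^ 2)) ∘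
        (MeasurableEquiv.toLp 2 (Fin p → ℝ)).symm := by
    funext y
    simp only [Function.comp, ← Real.exp_sum]
    congr 1
    rw [← Finset.sum_neg_distrib]
    refine Finset.sum_congr rfl fun i _ => ?_
    rw [neg_mul]; rfl
  constructor
  · rw [hf, mp.integrable_comp_emb (MeasurableEquiv.measurableEmbedding _)]
    exact Integrable.fintype_prod (f := fun i x => exp (-a i * x ^ 2))
      fun i => integrable_exp_neg_mul_sq (ha i)
  · rw [hf]
    have := mp.integral_comp' (fun x : Fin p → ℝ => ∏ i, exp (-a i * x i ^ 2))
    refine this.trans ?_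
    rw [integral_fintype_prod_volume_eq_prod (fun i x => exp (-a i * x ^ 2))]
    exact Finset.prod_congr rfl fun i _ => integral_gaussian (a i)

theorem change_var {p : ℕ} (L : EuclideanSpace ℝ (Fin p) ≃ₗ[ℝ] EuclideanSpace ℝ (Fin p)) :
    ∃ c : ℝ, 0 ≤ c ∧ ∀ f : EuclideanSpace ℝ (Fin p) → ℝ, Integrable (fun y => f (L y)) →
      Integrable f ∧ ∫ u, f u = c * ∫ y, f (L y) := by
  let E := EuclideanSpace ℝ (Fin p)
  have hd : LinearMap.det (L : E →ₗ[ℝ] E) ≠ 0 := (LinearEquiv.isUnit_det' L).ne_zero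
  have hmap := Measure.map_linearMap_addHaar_eq_smul_addHaar (volume : Measure E) hd
  have hemb : MeasurableEmbedding (L : E → E) :=
    L.toContinuousLinearEquiv.toHomeomorph.measurableEmbedding
  set d := LinearMap.det (L : E →ₗ[ℝ] E) with hddef
  have hpos : 0 < |d⁻¹| := by positivity
  refine ⟨|d⁻¹|⁻¹, by positivity, fun f hf => ?_⟩
  have hmap' : Measure.map (L : E → E) volume = ENNReal.ofReal |d⁻¹| • (volume : Measure E) := hmap
  have i1 : Integrable f (ENNReal.ofReal |d⁻¹| • (volume : Measure E)) := by
    rw [← hmap', hemb.integrable_map_iff]; exact hf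
  constructor
  · rwa [integrable_smul_measure (by simpa using hpos) (by simp)] at i1
  · have : ∫ u, f u ∂(Measure.map (L : E → E) volume) = ∫ y, f (L y) := hemb.integral_map f
    rw [← this, hmap', integral_smul_measure, ENNReal.toReal_ofReal hpos.le, smul_eq_mul,
      inv_mul_cancel_left₀ hpos.ne']

theorem exp_small {x : ℝ} (h0 : 0 ≤ x) (h1 : x ≤ 1 / 2) : exp x - 1 ≤ 3 / 2 * x := by
  have := Real.abs_exp_sub_one_sub_id_le (x := x) (by rw [abs_of_nonneg h0]; linarith)
  have := (abs_le.1 this).2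
  nlinarith

theorem sqrt_bound {ω b : ℝ} (hω0 : 0 ≤ ω) (hω : ω ≤ 1 / 3) (hb0 : 0 ≤ b) (hb1 : b ≤ 1) :
    √(π / ((1 - ω * b) / 2)) ≤ √(π / (1 / 2)) * exp (ω * b / (2 * (1 - ω))) := by
  have hx : ω * b ≤ ω := by nlinarith
  have h1 : 0 < 1 - ω * b := by linarith
  have h2 : 0 < 1 - ω := by linarith
  have hk : 1 / (1 - ω * b) ≤ exp (ω * b / (1 - ω)) := by
    calc 1 / (1 - ω * b) = ω * b / (1 - ω * b) + 1 := by field_simp; ring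
      _ ≤ ω * b / (1 - ω) + 1 := by gcongr
      _ ≤ _ := Real.add_one_le_exp _
  apply Real.sqrt_le_iff.2
  refine ⟨by positivity, ?_⟩
  rw [mul_pow, Real.sq_sqrt (by positivity), ← Real.exp_nat_mul]
  calc π / ((1 - ω * b) / 2) = π / (1 / 2) * (1 / (1 - ω * b)) := by field_simp
    _ ≤ π / (1 / 2) * exp (ω * b / (1 - ω)) := by gcongr
    _ = _ := by congr 2; push_cast; field_simp

theorem stmt_7 (p : ℕ)
    (DG DV : Matrix (Fin p) (Fin p) ℝ) (hDG : DG.PosDef) (hDV : DV.PosDef)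
    (hLoewner : (DG * DG - DV * DV).PosSemidef)
    (pG Z : ℝ) (hpG : pG = ((DV * DV) * (DG * DG)⁻¹).trace)
    (hZ : Z = ∫ u : EuclideanSpace ℝ (Fin p), exp (-(gaussNorm DG u) ^ 2 / 2))
    (F : EuclideanSpace ℝ (Fin p) → ℝ) (hFmeas : Measurable F)
    (U : Set (EuclideanSpace ℝ (Fin p))) (hU : MeasurableSet U)
    (ω : ℝ) (hω0 : 0 ≤ ω) (hω : ω ≤ 1 / 3)
    (hδ3 : ∀ u ∈ U, |F u + (gaussNorm DG u) ^ 2 / 2| ≤ ω * (gaussNorm DV u) ^ 2 / 2)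
    (hωpG : ω * pG ≤ 2 / 3)
    (g : EuclideanSpace ℝ (Fin p) → ℝ) (hgmeas : Measurable g) (hg : ∀ u, |g u| ≤ 1) :
    |(∫ u in U, exp (F u) * g u) -
        ∫ u in U, exp (-(gaussNorm DG u) ^ 2 / 2) * g u| ≤
      0.75 * ω * pG / (1 - ω) * Z := by
  obtain ⟨L, b, hb0, hb1, hsum, hG, hV⟩ := diag_exists DG DV hDG hDV hLoewner
  rw [← hpG] at hsum
  obtain ⟨c, hc, hcv⟩ := change_var L
  have h1ω : 0 < 1 - ω := by linarith
  have hωb : ∀ i, ω * b i ≤ ω := fun i => by nlinarith [hb0 i, hb1 i]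
  obtain ⟨i1, e1⟩ := gauss_prod (p := p) (fun _ => 1 / 2) (fun _ => by norm_num)
  obtain ⟨i2, e2⟩ := gauss_prod (p := p) (fun i => (1 - ω * b i) / 2)
    (fun i => by have := hωb i; linarith)
  have f1 : (fun y => exp (-(gaussNorm DG (L y)) ^ 2 / 2)) =
      fun y : EuclideanSpace ℝ (Fin p) => exp (-∑ i, 1 / 2 * y i ^ 2) := by
    funext y; rw [hG, ← Finset.mul_sum]; ring_nf
  have f2 : (fun y => exp (-(gaussNorm DG (L y)) ^ 2 / 2 + ω * gaussNorm DV (L y) ^ 2 / 2)) =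
      fun y : EuclideanSpace ℝ (Fin p) => exp (-∑ i, (1 - ω * b i) / 2 * y i ^ 2) := by
    funext y
    rw [hG, hV]
    congr 1
    have : ∀ i, (1 - ω * b i) / 2 * y i ^ 2 = 1 / 2 * y i ^ 2 - ω / 2 * (b i * y i ^ 2) :=
      fun i => by ring
    simp only [this, Finset.sum_sub_distrib, ← Finset.mul_sum]
    ring
  obtain ⟨j1, k1⟩ := hcv (fun u => exp (-(gaussNorm DG u) ^ 2 / 2)) (by rw [f1]; exact i1)
  obtain ⟨j2, k2⟩ := hcv
    (fun u => exp (-(gaussNorm DG u) ^ 2 / 2 + ω * gaussNorm DV u ^ 2 / 2)) (by rw [f2]; exact i2)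
  rw [f1, e1, ← hZ] at k1
  rw [f2, e2] at k2
  have hZ0 : 0 ≤ Z := by rw [k1]; positivity
  have hpG0 : 0 ≤ pG := by rw [← hsum]; exact Finset.sum_nonneg fun i _ => hb0 i
  have key : c * ∏ i, √(π / ((1 - ω * b i) / 2)) ≤ Z * exp (ω * pG / (2 * (1 - ω))) := by
    rw [k1, mul_assoc]
    refine mul_le_mul_of_nonneg_left ?_ hc
    have : exp (ω * pG / (2 * (1 - ω))) = ∏ i, exp (ω * b i / (2 * (1 - ω))) := by
      rw [← Real.exp_sum, ← hsum, Finset.mul_sum, Finset.sum_div]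
    rw [this, ← Finset.prod_mul_distrib]
    exact Finset.prod_le_prod (fun i _ => Real.sqrt_nonneg _)
      fun i _ => sqrt_bound hω0 hω (hb0 i) (hb1 i)
  have hx := exp_small (x := ω * pG / (2 * (1 - ω))) (by positivity)
    (by rw [div_le_iff₀ (by positivity)]; linarith)
  have hFle : ∀ u ∈ U, exp (F u) ≤
      exp (-(gaussNorm DG u) ^ 2 / 2 + ω * gaussNorm DV u ^ 2 / 2) := by
    intro u hu
    have := (abs_le.1 (hδ3 u hu)).2
    apply Real.exp_le_exp.2
    linarith
  have m1 : IntegrableOn (fun u => exp (F u) * g u) U := by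
    refine Integrable.mono' (j2.integrableOn (s := U))
      (by fun_prop) ?_
    refine (ae_restrict_iff' hU).2 (ae_of_all _ fun u hu => ?_)
    rw [norm_mul, Real.norm_eq_abs, Real.norm_eq_abs, abs_of_pos (exp_pos _)]
    have := hFle u hu
    have := hg u
    have := exp_pos (F u)
    nlinarith
  have m2 : IntegrableOn (fun u => exp (-(gaussNorm DG u) ^ 2 / 2) * g u) U := by
    refine Integrable.mono' (j1.integrableOn (s := U))
      (j1.aestronglyMeasurable.restrict.mul hgmeas.aestronglyMeasurable) ?_
    refine ae_of_all _ fun u => ?_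
    rw [norm_mul, Real.norm_eq_abs, Real.norm_eq_abs, abs_of_pos (exp_pos _)]
    have := hg u
    have := exp_pos (-(gaussNorm DG u) ^ 2 / 2)
    nlinarith
  rw [← integral_sub m1 m2, ← Real.norm_eq_abs]
  have j3 := j2.sub j1
  have hpt : ∀ u ∈ U, ‖exp (F u) * g u - exp (-(gaussNorm DG u) ^ 2 / 2) * g u‖ ≤
      exp (-(gaussNorm DG u) ^ 2 / 2 + ω * gaussNorm DV u ^ 2 / 2)
        - exp (-(gaussNorm DG u) ^ 2 / 2) := by
    intro u hu
    rw [← sub_mul, norm_mul, Real.norm_eq_abs, Real.norm_eq_abs]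
    refine (mul_le_of_le_one_right (abs_nonneg _) (hg u)).trans ?_
    have hd := abs_le.1 (hδ3 u hu)
    set q := -(gaussNorm DG u) ^ 2 / 2 with hq
    set t := ω * gaussNorm DV u ^ 2 / 2 with ht
    have hlow : q - t ≤ F u := by rw [hq]; linarith [hd.1]
    have hlow' := Real.exp_le_exp.2 hlow
    rw [abs_le]
    constructor
    · have h2 : 2 * exp q ≤ exp (q + t) + exp (q - t) := by
        have hp : exp (q + t) = exp q * exp t := Real.exp_add _ _
        have hm : exp (q - t) = exp q * exp (-t) := by rw [← Real.exp_add]; ring_nf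
        have ha := Real.add_one_le_exp t
        have hb := Real.add_one_le_exp (-t)
        rw [hp, hm]
        nlinarith [exp_pos q]
      linarith
    · linarith [hFle u hu]
  calc ‖∫ u in U, (exp (F u) * g u - exp (-(gaussNorm DG u) ^ 2 / 2) * g u)‖
      ≤ ∫ u in U, (exp (-(gaussNorm DG u) ^ 2 / 2 + ω * gaussNorm DV u ^ 2 / 2)
        - exp (-(gaussNorm DG u) ^ 2 / 2)) :=
        norm_integral_le_of_norm_le j3.integrableOn
          ((ae_restrict_iff' hU).2 (ae_of_all _ hpt))
    _ ≤ ∫ u, (exp (-(gaussNorm DG u) ^ 2 / 2 + ω * gaussNorm DV u ^ 2 / 2)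
        - exp (-(gaussNorm DG u) ^ 2 / 2)) := by
        refine setIntegral_le_integral j3 (ae_of_all _ fun u => ?_)
        have : 0 ≤ ω * gaussNorm DV u ^ 2 / 2 := by positivity
        simp only [Pi.zero_apply]
        exact sub_nonneg.2 (Real.exp_le_exp.2 (by linarith))
    _ = c * ∏ i, √(π / ((1 - ω * b i) / 2)) - Z := by
        rw [integral_sub j2 j1, k2, ← hZ]
    _ ≤ Z * (exp (ω * pG / (2 * (1 - ω))) - 1) := by linarith
    _ ≤ Z * (3 / 2 * (ω * pG / (2 * (1 - ω)))) := mul_le_mul_of_nonneg_left hx hZ0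
    _ = 0.75 * ω * pG / (1 - ω) * Z := by
        field_simp; ring
end

section
/- Under the stated assumptions, ∫_{Uᶜ} e^{F(u)} du ≤ 4·e^{−x − p_G/2} · Z. -/
open MeasureTheory Real Matrix

lemma aux_matrix {p : ℕ} (DG DV : Matrix (Fin p) (Fin p) ℝ) (hDG : DG.PosDef) (hDV : DV.PosDef)
    (hL : (DG * DG - DV * DV).PosSemidef) (m : ℝ) (hm0 : 0 ≤ m) (hm1 : m < 1) :
    ∃ S : Matrix (Fin p) (Fin p) ℝ, Sᵀ * S = DG * DG - m • (DV * DV) ∧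
      (1 - m) ^ ((DV * DV) * (DG * DG)⁻¹).trace * DG.det ^ 2 ≤ S.det ^ 2 := by
  have hdet : IsUnit DG.det := hDG.det_pos.ne'.isUnit
  have hGt : DGᵀ = DG := (conjTranspose_eq_transpose_of_trivial DG).symm.trans hDG.isHermitian.eq
  have hVt : DVᵀ = DV := (conjTranspose_eq_transpose_of_trivial DV).symm.trans hDV.isHermitian.eq
  have hit : (DG⁻¹)ᴴ = DG⁻¹ := by
    rw [conjTranspose_eq_transpose_of_trivial, transpose_nonsing_inv, hGt]
  set B := DG⁻¹ * (DV * DV) * DG⁻¹ with hB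
  have hGi : DG * DG⁻¹ = 1 := mul_nonsing_inv _ hdet
  have hiG : DG⁻¹ * DG = 1 := nonsing_inv_mul _ hdet
  have hGBG : DG * B * DG = DV * DV := by
    calc DG * B * DG = (DG * DG⁻¹) * (DV * DV) * (DG⁻¹ * DG) := by
          rw [hB]; simp only [Matrix.mul_assoc]
      _ = _ := by rw [hGi, hiG, Matrix.one_mul, Matrix.mul_one]
  have hVV : (DV * DV).PosSemidef := by
    have := posSemidef_conjTranspose_mul_self DV
    rwa [conjTranspose_eq_transpose_of_trivial, hVt] at this
  have hBpsd : B.PosSemidef := by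
    have := hVV.mul_mul_conjTranspose_same DG⁻¹
    rwa [hit] at this
  have h1B : (1 - B).PosSemidef := by
    have := hL.mul_mul_conjTranspose_same DG⁻¹
    rw [hit] at this
    have e : DG⁻¹ * (DG * DG - DV * DV) * DG⁻¹ = 1 - B := by
      rw [Matrix.mul_sub, Matrix.sub_mul, ← Matrix.mul_assoc DG⁻¹ DG DG, hiG, Matrix.one_mul, hGi]
    rwa [e] at this
  have htr : ((DV * DV) * (DG * DG)⁻¹).trace = B.trace := by
    rw [Matrix.mul_inv_rev, hB, Matrix.trace_mul_comm (DG⁻¹ * (DV * DV)), Matrix.trace_mul_comm,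
      Matrix.mul_assoc]
  have hH := hBpsd.isHermitian
  set lam := hH.eigenvalues with hlam
  obtain ⟨V, hV1, hV2, hspec⟩ : ∃ V : Matrix (Fin p) (Fin p) ℝ, Vᵀ * V = 1 ∧ V * Vᵀ = 1 ∧
      B = V * diagonal lam * Vᵀ := by
    refine ⟨hH.eigenvectorUnitary, ?_, ?_, ?_⟩
    · have := Unitary.coe_star_mul_self hH.eigenvectorUnitary
      simpa [star_eq_conjTranspose] using this
    · have := Unitary.coe_mul_star_self hH.eigenvectorUnitary
      simpa [star_eq_conjTranspose] using this
    · have := hH.spectral_theorem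
      rw [Unitary.conjStarAlgAut_apply] at this
      simpa [star_eq_conjTranspose, Function.comp_def] using this
  have hlam0 : ∀ i, 0 ≤ lam i := hBpsd.eigenvalues_nonneg
  have hlam1 : ∀ i, lam i ≤ 1 := by
    have := h1B.conjTranspose_mul_mul_same V
    rw [conjTranspose_eq_transpose_of_trivial, hspec] at this
    have e : Vᵀ * (1 - V * diagonal lam * Vᵀ) * V = diagonal (fun i => 1 - lam i) := by
      calc _ = Vᵀ * V - (Vᵀ * V) * diagonal lam * (Vᵀ * V) := by
            rw [Matrix.mul_sub, Matrix.sub_mul]; simp only [Matrix.mul_assoc, Matrix.mul_one]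
        _ = _ := by rw [hV1, Matrix.one_mul, Matrix.mul_one, ← diagonal_one, diagonal_sub]
    rw [e, posSemidef_diagonal_iff] at this
    intro i; have := this i; linarith
  have hpos : ∀ i, 0 ≤ 1 - m * lam i := fun i => by
    nlinarith [hlam0 i, hlam1 i]
  have hSS : (diagonal (fun i => √(1 - m * lam i)) * Vᵀ * DG)ᵀ *
      (diagonal (fun i => √(1 - m * lam i)) * Vᵀ * DG) = DG * (V * diagonal (fun i => 1 - m * lam i) * Vᵀ) * DG := by
    rw [transpose_mul, transpose_mul, transpose_transpose, diagonal_transpose, hGt]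
    have : diagonal (fun i => 1 - m * lam i) = diagonal (fun i => √(1 - m * lam i)) * diagonal (fun i => √(1 - m * lam i)) := by
      rw [diagonal_mul_diagonal]; congr 1; ext i; rw [Real.mul_self_sqrt (hpos i)]
    rw [this]; simp only [Matrix.mul_assoc]
  refine ⟨diagonal (fun i => √(1 - m * lam i)) * Vᵀ * DG, ?_, ?_⟩
  · rw [hSS]
    have : V * diagonal (fun i => 1 - m * lam i) * Vᵀ = 1 - m • B := by
      have e : diagonal (fun i => 1 - m * lam i) = 1 - m • diagonal lam := by
        rw [← diagonal_one, ← diagonal_smul, diagonal_sub]; rfl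
      rw [e, Matrix.mul_sub, Matrix.sub_mul, Matrix.mul_one, hV2, hspec, Matrix.mul_smul, Matrix.smul_mul]
    rw [this, Matrix.mul_sub, Matrix.sub_mul, Matrix.mul_one, Matrix.mul_smul, Matrix.smul_mul, hGBG]
  · have hd : (diagonal (fun i => √(1 - m * lam i)) * Vᵀ * DG).det ^ 2 = (∏ i, (1 - m * lam i)) * DG.det ^ 2 := by
      have h := congrArg det hSS
      have hv := congrArg det hV2
      simp only [det_mul, det_transpose, det_diagonal, det_one] at h hv ⊢
      rw [pow_two, h]
      linear_combination (DG.det ^ 2 * ∏ i, (1 - m * lam i)) * hv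
    rw [hd, htr, hH.trace_eq_sum_eigenvalues]
    refine mul_le_mul_of_nonneg_right ?_ (sq_nonneg _)
    simp only [RCLike.ofReal_real_eq_id, id]
    rw [Real.rpow_sum_of_pos (by linarith)]
    refine Finset.prod_le_prod (fun i _ => Real.rpow_nonneg (by linarith) _) (fun i _ => ?_)
    have := _root_.rpow_one_add_le_one_add_mul_self (s := -m) (by linarith) (hlam0 i) (hlam1 i)
    calc _ = (1 + -m) ^ lam i := by rw [← sub_eq_add_neg]
      _ ≤ _ := this
      _ = _ := by ring

lemma aux_gauss_sq {p : ℕ} (D : Matrix (Fin p) (Fin p) ℝ) (u : EuclideanSpace ℝ (Fin p)) :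
    gaussNorm D u ^ 2 = u.ofLp ⬝ᵥ ((Dᵀ * D) *ᵥ u.ofLp) := by
  rw [gaussNorm, EuclideanSpace.real_norm_sq_eq, ← Matrix.mulVec_mulVec, Matrix.dotProduct_mulVec,
    Matrix.vecMul_transpose, toLpLin_apply]
  simp [dotProduct, pow_two]

lemma aux_gauss_cont {p : ℕ} (D : Matrix (Fin p) (Fin p) ℝ) : Continuous (gaussNorm D) := by
  unfold gaussNorm
  exact (LinearMap.continuous_of_finiteDimensional _).norm

noncomputable def auxC (p : ℕ) : ENNReal :=
  ∫⁻ u : EuclideanSpace ℝ (Fin p), ENNReal.ofReal (exp (-‖u‖ ^ 2 / 2))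

lemma auxC_ne_top (p : ℕ) : auxC p ≠ ⊤ := by
  have h := (GaussianFourier.integrable_cexp_neg_mul_sq_norm_add (V := EuclideanSpace ℝ (Fin p))
    (b := 1/2) (by norm_num) 0 0).norm
  have h2 : Integrable (fun u : EuclideanSpace ℝ (Fin p) => exp (-‖u‖ ^ 2 / 2)) := by
    refine h.congr (Filter.Eventually.of_forall fun u => ?_)
    simp only [Complex.norm_exp]
    congr 1
    have : (-(1/2 : ℂ) * (‖u‖ : ℂ) ^ 2 + 0 * (inner ℝ (0 : EuclideanSpace ℝ (Fin p)) u : ℝ)) = ((-‖u‖^2/2 : ℝ) : ℂ) := by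
      push_cast; ring
    rw [this, Complex.ofReal_re]
  rw [auxC, ← ofReal_integral_eq_lintegral_ofReal h2 (Filter.Eventually.of_forall fun u => (exp_pos _).le)]
  exact ENNReal.ofReal_ne_top

lemma aux_lint {p : ℕ} (S : Matrix (Fin p) (Fin p) ℝ) (hS : S.det ≠ 0) :
    ∫⁻ u : EuclideanSpace ℝ (Fin p), ENNReal.ofReal (exp (-gaussNorm S u ^ 2 / 2)) =
      ENNReal.ofReal |S.det|⁻¹ * auxC p := by
  have hd : LinearMap.det (Matrix.toEuclideanLin S) = S.det := by simp
  have h := Measure.map_linearMap_addHaar_eq_smul_addHaar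
    (volume : Measure (EuclideanSpace ℝ (Fin p))) (f := Matrix.toEuclideanLin S) (by rwa [hd])
  have hm : Measurable (Matrix.toEuclideanLin S) :=
    (LinearMap.continuous_of_finiteDimensional _).measurable
  have h2 := lintegral_map (μ := (volume : Measure (EuclideanSpace ℝ (Fin p))))
    (f := fun u : EuclideanSpace ℝ (Fin p) => ENNReal.ofReal (exp (-‖u‖ ^ 2 / 2))) (by fun_prop) hm
  rw [h, lintegral_smul_measure, hd, abs_inv] at h2
  simpa [gaussNorm, auxC] using h2.symm

lemma aux_mgf {p : ℕ} (DG DV : Matrix (Fin p) (Fin p) ℝ) (hDG : DG.PosDef) (hDV : DV.PosDef)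
    (hL : (DG * DG - DV * DV).PosSemidef) (m : ℝ) (hm0 : 0 ≤ m) (hm1 : m < 1) :
    ∫⁻ u : EuclideanSpace ℝ (Fin p), ENNReal.ofReal (exp (m * gaussNorm DV u ^ 2 / 2 - gaussNorm DG u ^ 2 / 2))
    ≤ ENNReal.ofReal ((1 - m) ^ (-((DV * DV) * (DG * DG)⁻¹).trace / 2)) *
      ∫⁻ u : EuclideanSpace ℝ (Fin p), ENNReal.ofReal (exp (-gaussNorm DG u ^ 2 / 2)) := by
  have hGt : DGᵀ = DG := (conjTranspose_eq_transpose_of_trivial DG).symm.trans hDG.isHermitian.eq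
  have hVt : DVᵀ = DV := (conjTranspose_eq_transpose_of_trivial DV).symm.trans hDV.isHermitian.eq
  obtain ⟨S, hS, hdet⟩ := aux_matrix DG DV hDG hDV hL m hm0 hm1
  set q := ((DV * DV) * (DG * DG)⁻¹).trace
  have hG0 := hDG.det_pos
  have hq : 0 < (1 - m) ^ q := Real.rpow_pos_of_pos (by linarith) _
  have hS0 : S.det ≠ 0 := by
    intro h0; rw [h0] at hdet
    have : 0 < (1 - m) ^ q * DG.det ^ 2 := by positivity
    norm_num at hdet; linarith
  have e : ∀ u, m * gaussNorm DV u ^ 2 / 2 - gaussNorm DG u ^ 2 / 2 = -gaussNorm S u ^ 2 / 2 := by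
    intro u
    rw [aux_gauss_sq S, aux_gauss_sq, aux_gauss_sq, hS, hGt, hVt, Matrix.sub_mulVec, dotProduct_sub,
      Matrix.smul_mulVec, dotProduct_smul, smul_eq_mul]
    ring
  simp only [e]
  rw [aux_lint S hS0, aux_lint DG hG0.ne', ← mul_assoc, ← ENNReal.ofReal_mul (by positivity)]
  gcongr
  rw [abs_of_pos hG0]
  have hq2 : 0 < (1 - m) ^ (q / 2) := Real.rpow_pos_of_pos (by linarith) _
  have hsq : ((1 - m) ^ (q / 2) * DG.det) ^ 2 ≤ |S.det| ^ 2 := by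
    rw [sq_abs, mul_pow, ← Real.rpow_natCast, ← Real.rpow_mul (by linarith)]
    convert hdet using 3
    push_cast; ring
  have h1 := (pow_le_pow_iff_left₀ (by positivity) (abs_nonneg S.det) two_ne_zero).1 hsq
  rw [neg_div, Real.rpow_neg (by linarith), ← mul_inv]
  exact inv_anti₀ (by positivity) h1

noncomputable def auxM {p : ℕ} (DG : Matrix (Fin p) (Fin p) ℝ) :
    Measure (EuclideanSpace ℝ (Fin p)) :=
  volume.withDensity (fun u => ENNReal.ofReal (exp (-gaussNorm DG u ^ 2 / 2)))

lemma auxM_univ {p : ℕ} (DG : Matrix (Fin p) (Fin p) ℝ) : auxM DG Set.univ =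
    ∫⁻ u : EuclideanSpace ℝ (Fin p), ENNReal.ofReal (exp (-gaussNorm DG u ^ 2 / 2)) := by
  rw [auxM, withDensity_apply _ MeasurableSet.univ, Measure.restrict_univ]

lemma aux_chern (q s : ℝ) (hq : 0 < q) (hs : √q < s) :
    exp (-(1 - q / s ^ 2) * s ^ 2 / 2) * (1 - (1 - q / s ^ 2)) ^ (-q / 2) ≤
      exp (-(s - √q) ^ 2 / 2) := by
  have hq' : 0 < √q := Real.sqrt_pos.2 hq
  have hs0 : 0 < s := hq'.trans hs
  have hsq : √q ^ 2 = q := Real.sq_sqrt hq.le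
  have e1 : 1 - (1 - q / s ^ 2) = (s / √q) ^ (-2 : ℝ) := by
    rw [Real.rpow_neg (by positivity), Real.rpow_two, div_pow, hsq]; field_simp; ring
  rw [e1, ← Real.rpow_mul (by positivity), Real.rpow_def_of_pos (by positivity), ← Real.exp_add]
  apply Real.exp_le_exp.2
  have hl := Real.log_le_sub_one_of_pos (show 0 < s / √q by positivity)
  have h2 : q * Real.log (s / √q) ≤ s * √q - q := by
    calc _ ≤ q * (s / √q - 1) := by gcongr
      _ = √q ^ 2 * (s / √q - 1) := by rw [hsq]
      _ = s * √q - √q ^ 2 := by field_simp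
      _ = _ := by rw [hsq]
  have h3 : -(1 - q / s ^ 2) * s ^ 2 / 2 = -(s ^ 2 - q) / 2 := by field_simp
  rw [h3]; nlinarith

lemma aux_tail {p : ℕ} (DG DV : Matrix (Fin p) (Fin p) ℝ) (hDG : DG.PosDef) (hDV : DV.PosDef)
    (hL : (DG * DG - DV * DV).PosSemidef) (q : ℝ) (hq : q = ((DV * DV) * (DG * DG)⁻¹).trace)
    (hq0 : 0 < q) (s : ℝ) (hs : √q < s) :
    auxM DG {u | s < gaussNorm DV u} ≤ ENNReal.ofReal (exp (-(s - √q) ^ 2 / 2)) * auxM DG Set.univ := by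
  have hq' : 0 < √q := Real.sqrt_pos.2 hq0
  have hs0 : 0 < s := hq'.trans hs
  have hms : MeasurableSet {u | s < gaussNorm DV u} :=
    measurableSet_lt measurable_const (aux_gauss_cont DV).measurable
  have hqs : q < s ^ 2 := by rw [← Real.sq_sqrt hq0.le]; gcongr
  set m := 1 - q / s ^ 2 with hm
  have hm0 : 0 ≤ m := by
    rw [hm, sub_nonneg, div_le_one (by positivity)]; exact hqs.le
  have hm1 : m < 1 := by rw [hm]; linarith [show 0 < q / s ^ 2 by positivity]
  rw [auxM_univ, auxM, withDensity_apply _ hms]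
  calc _ ≤ ∫⁻ u in {u | s < gaussNorm DV u}, ENNReal.ofReal (exp (-m * s ^ 2 / 2)) *
          ENNReal.ofReal (exp (m * gaussNorm DV u ^ 2 / 2 - gaussNorm DG u ^ 2 / 2)) := by
        refine setLIntegral_mono' hms fun u hu => ?_
        rw [← ENNReal.ofReal_mul (exp_pos _).le, ← Real.exp_add]
        refine ENNReal.ofReal_le_ofReal (Real.exp_le_exp.2 ?_)
        have hu' : s ^ 2 ≤ gaussNorm DV u ^ 2 := by
          have : s < gaussNorm DV u := hu
          gcongr
        nlinarith
    _ ≤ ∫⁻ u, ENNReal.ofReal (exp (-m * s ^ 2 / 2)) *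
          ENNReal.ofReal (exp (m * gaussNorm DV u ^ 2 / 2 - gaussNorm DG u ^ 2 / 2)) :=
        setLIntegral_le_lintegral _ _
    _ = ENNReal.ofReal (exp (-m * s ^ 2 / 2)) * ∫⁻ u : EuclideanSpace ℝ (Fin p),
          ENNReal.ofReal (exp (m * gaussNorm DV u ^ 2 / 2 - gaussNorm DG u ^ 2 / 2)) :=
        lintegral_const_mul' _ _ ENNReal.ofReal_ne_top
    _ ≤ _ := by
        grw [aux_mgf DG DV hDG hDV hL m hm0 hm1]
        rw [← hq, ← mul_assoc, ← ENNReal.ofReal_mul (exp_pos _).le]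
        gcongr
        exact aux_chern q s hq0 hs

lemma aux_int_s12 (a c : ℝ) (ha : 0 < a) (hc : 0 < c) :
    ∫⁻ s in Set.Ioi (0:ℝ), ENNReal.ofReal ((s + c) * exp (-(a * s))) =
      ENNReal.ofReal (1 / a ^ 2 + c / a) := by
  have hd : ∀ s ∈ Set.Ici (0:ℝ), HasDerivAt (fun s => -((s + c) / a + 1 / a ^ 2) * exp (-(a * s)))
      ((s + c) * exp (-(a * s))) s := by
    intro s _
    have h1 : HasDerivAt (fun s : ℝ => -((s + c) / a + 1 / a ^ 2)) (-(1 / a)) s :=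
      ((((hasDerivAt_id s).add_const c).div_const a).add_const _).neg
    have h2 : HasDerivAt (fun s : ℝ => exp (-(a * s))) (exp (-(a * s)) * (-(a * 1))) s :=
      (((hasDerivAt_id s).const_mul a).neg).exp
    refine (h1.mul h2).congr_deriv ?_
    field_simp
    ring
  have ht : Filter.Tendsto (fun s => -((s + c) / a + 1 / a ^ 2) * exp (-(a * s))) Filter.atTop (nhds 0) := by
    have hA : Filter.Tendsto (fun s : ℝ => a * s) Filter.atTop Filter.atTop :=
      Filter.tendsto_id.const_mul_atTop ha
    have h1 := (Real.tendsto_pow_mul_exp_neg_atTop_nhds_zero 1).comp hA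
    have h0 := (Real.tendsto_pow_mul_exp_neg_atTop_nhds_zero 0).comp hA
    have := (h1.const_mul (-(1 / a ^ 2))).add (h0.const_mul (-(c / a + 1 / a ^ 2)))
    simp only [mul_zero, add_zero] at this
    refine this.congr fun s => ?_
    simp only [Function.comp]
    field_simp
    ring
  have hn : ∀ s ∈ Set.Ioi (0:ℝ), 0 ≤ (s + c) * exp (-(a * s)) := fun s hs => by
    have : 0 < s := hs
    positivity
  have hi := integrableOn_Ioi_deriv_of_nonneg' hd hn ht
  have he := integral_Ioi_of_hasDerivAt_of_nonneg' hd hn ht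
  rw [← ofReal_integral_eq_lintegral_ofReal hi (ae_restrict_of_forall_mem measurableSet_Ioi hn), he]
  congr 1
  simp; ring

lemma aux_main {p : ℕ} (DG DV : Matrix (Fin p) (Fin p) ℝ) (hDG : DG.PosDef) (hDV : DV.PosDef)
    (hL : (DG * DG - DV * DV).PosSemidef) (q : ℝ) (hq : q = ((DV * DV) * (DG * DG)⁻¹).trace)
    (hq0 : 0 < q) (x r : ℝ) (hx : 2 ≤ x) (hr : r = 2 * √q + √(2 * x)) :
    ∫⁻ u in {u | r < gaussNorm DV u}, ENNReal.ofReal (exp (gaussNorm DV u ^ 2 / 2 - r * gaussNorm DV u / 2))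
      ∂(auxM DG) ≤ ENNReal.ofReal (4 * exp (-x - q / 2)) * auxM DG Set.univ := by
  have hq' : 0 < √q := Real.sqrt_pos.2 hq0
  have hsq : √q ^ 2 = q := Real.sq_sqrt hq0.le
  obtain ⟨a, ha⟩ : ∃ a, a = √(2 * x) / 2 := ⟨_, rfl⟩
  have hax : 2 * a ^ 2 = x := by
    rw [ha, div_pow, Real.sq_sqrt (by linarith)]; ring
  have ha0 : 0 < a := by rw [ha]; have : 0 < 2 * x := by linarith
                         positivity
  have ha1 : 1 ≤ a := by nlinarith
  have hra : r = 2 * √q + 2 * a := by rw [hr, ha]; ring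
  have hrq : √q < r := by linarith
  have hr0 : 0 < r := by linarith
  set g : ℝ → ℝ := fun s => (s + r / 2) * exp (s * (s + r) / 2) with hg
  have hgc : Continuous g := by fun_prop
  have hgi : ∀ b, ∫ s in (0:ℝ)..b, g s = exp (b * (b + r) / 2) - 1 := by
    intro b
    rw [intervalIntegral.integral_eq_sub_of_hasDerivAt (f := fun s => exp (s * (s + r) / 2)) (f' := g)]
    · simp
    · intro s _
      have h1 : HasDerivAt (fun s : ℝ => s * (s + r) / 2) ((1 * (s + r) + s * 1) / 2) s :=
        ((hasDerivAt_id s).mul ((hasDerivAt_id s).add_const r)).div_const 2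
      refine h1.exp.congr_deriv ?_
      simp only [hg]; ring
    · exact hgc.intervalIntegrable _ _
  set t := gaussNorm DV with ht
  have htm : Measurable t := (aux_gauss_cont DV).measurable
  have hms : MeasurableSet {u | r < t u} := measurableSet_lt measurable_const htm
  have hlc := lintegral_comp_eq_lintegral_meas_lt_mul (f := fun u => max (t u - r) 0) (g := g) (auxM DG)
    (Filter.Eventually.of_forall fun u => le_max_right _ _)
    ((htm.sub_const r).max measurable_const).aemeasurable
    (fun b _ => hgc.intervalIntegrable _ _)
    (ae_restrict_of_forall_mem measurableSet_Ioi fun s hs => by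
      have : 0 < s := hs
      simp only [hg]; positivity)
  set K := exp (-r * a - q / 2) with hK
  have hb : ∀ s, 0 ≤ s → exp (-(s + r - √q) ^ 2 / 2) * exp (s * (s + r) / 2) = K * exp (-(a * s)) := by
    intro s _
    rw [hK, ← Real.exp_add, ← Real.exp_add]
    congr 1
    rw [hra]; nlinarith
  calc _ ≤ ∫⁻ u in {u | r < t u}, (1 + ENNReal.ofReal (∫ s in (0:ℝ)..max (t u - r) 0, g s)) ∂(auxM DG) := by
        refine setLIntegral_mono' hms fun u hu => ?_
        have hu' : r < t u := hu
        rw [hgi, max_eq_left (by linarith), ← ENNReal.ofReal_one,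
          ← ENNReal.ofReal_add zero_le_one]
        · refine ENNReal.ofReal_le_ofReal (le_of_eq ?_)
          rw [add_sub_cancel]; congr 1; ring
        · rw [sub_nonneg]; apply Real.one_le_exp
          have : 0 < t u - r := by linarith
          positivity
    _ = auxM DG {u | r < t u} + ∫⁻ u in {u | r < t u}, ENNReal.ofReal (∫ s in (0:ℝ)..max (t u - r) 0, g s) ∂(auxM DG) := by
        rw [lintegral_add_left measurable_const]; simp
    _ ≤ auxM DG {u | r < t u} + ∫⁻ u, ENNReal.ofReal (∫ s in (0:ℝ)..max (t u - r) 0, g s) ∂(auxM DG) := by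
        gcongr; exact Measure.restrict_le_self
    _ = auxM DG {u | r < t u} + ∫⁻ s in Set.Ioi 0, auxM DG {u | s < max (t u - r) 0} * ENNReal.ofReal (g s) := by
        rw [hlc]
    _ ≤ ENNReal.ofReal K * auxM DG Set.univ + ∫⁻ s in Set.Ioi 0,
          (ENNReal.ofReal K * auxM DG Set.univ) * ENNReal.ofReal ((s + r / 2) * exp (-(a * s))) := by
        refine add_le_add ?_ (setLIntegral_mono' measurableSet_Ioi fun s hs => ?_)
        · have := aux_tail DG DV hDG hDV hL q hq hq0 r hrq
          have e := hb 0 le_rfl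
          simp at e
          rwa [e] at this
        · have hs' : 0 < s := hs
          have hset : {u | s < max (t u - r) 0} = {u | s + r < t u} := by
            ext u; simp only [Set.mem_ofPred_eq, lt_max_iff]
            constructor
            · rintro (h | h) <;> linarith
            · intro h; left; linarith
          rw [hset]
          grw [aux_tail DG DV hDG hDV hL q hq hq0 (s + r) (by linarith)]
          rw [mul_right_comm, mul_right_comm (ENNReal.ofReal K), ← ENNReal.ofReal_mul (exp_pos _).le,
            ← ENNReal.ofReal_mul (exp_pos _).le]
          refine le_of_eq ?_
          congr 2
          have := hb s hs'.le
          simp only [hg]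
          linear_combination (s + r / 2) * this
    _ = ENNReal.ofReal K * auxM DG Set.univ + ENNReal.ofReal K * auxM DG Set.univ *
          ENNReal.ofReal (1 / a ^ 2 + (r / 2) / a) := by
        rw [lintegral_const_mul _ (by fun_prop), aux_int_s12 a (r / 2) ha0 (by positivity)]
    _ = ENNReal.ofReal (K * (1 + (1 / a ^ 2 + (r / 2) / a))) * auxM DG Set.univ := by
        have : 0 ≤ 1 / a ^ 2 + (r / 2) / a := by positivity
        rw [ENNReal.ofReal_mul (exp_pos _).le, ENNReal.ofReal_add zero_le_one this, ENNReal.ofReal_one]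
        ring
    _ ≤ _ := by
        refine mul_le_mul_left (ENNReal.ofReal_le_ofReal ?_) _
        have hKe : K = exp (-x - q / 2) * exp (-(2 * a * √q)) := by
          rw [hK, ← Real.exp_add]; congr 1; rw [hra, ← hax]; ring
        rw [hKe, mul_assoc, mul_comm 4]
        gcongr
        rw [Real.exp_neg, inv_mul_le_iff₀ (exp_pos _)]
        have h1 : 1 / a ^ 2 ≤ 1 := by rw [div_le_one (by positivity)]; nlinarith
        have h2 : r / 2 / a ≤ 1 + 2 * a * √q := by
          rw [div_le_iff₀ ha0, hra]; nlinarith [mul_pos ha0 hq', mul_self_nonneg (a - 1)]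
        have h3 := Real.add_one_le_exp (2 * a * √q)
        have : 0 < 2 * a * √q := by positivity
        linarith

theorem stmt_12 (p : ℕ)
    (DG DV : Matrix (Fin p) (Fin p) ℝ) (hDG : DG.PosDef) (hDV : DV.PosDef)
    (hLoewner : (DG * DG - DV * DV).PosSemidef)
    (pG Z : ℝ) (hpG : pG = ((DV * DV) * (DG * DG)⁻¹).trace)
    (hZ : Z = ∫ u : EuclideanSpace ℝ (Fin p), exp (-(gaussNorm DG u) ^ 2 / 2))
    (ℓ : EuclideanSpace ℝ (Fin p) → ℝ)
    (hℓconc : ConcaveOn ℝ Set.univ ℓ) (hℓsmooth : ContDiff ℝ 2 ℓ)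
    (hℓhess : ∀ u, iteratedFDeriv ℝ 2 ℓ 0 ![u, u] = -(gaussNorm DV u) ^ 2)
    (F : EuclideanSpace ℝ (Fin p) → ℝ)
    (hF : ∀ u, F u = ℓ u - ℓ 0 - fderiv ℝ ℓ 0 u -
      (gaussNorm DG u) ^ 2 / 2 + (gaussNorm DV u) ^ 2 / 2)
    (ν xx rG : ℝ) (hν0 : 0 < ν) (hν1 : ν < 1) (hxx : 2 ≤ xx)
    (hrG : rG = 2 * Real.sqrt pG + Real.sqrt (2 * xx))
    (U : Set (EuclideanSpace ℝ (Fin p)))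
    (hUdef : U = {u | gaussNorm DV u ≤ rG / ν})
    (ω : ℝ) (hω0 : 0 ≤ ω) (hων : ω ≤ 1 - ν)
    (hδ : ∀ u ∈ U,
      |ℓ u - ℓ 0 - fderiv ℝ ℓ 0 u + (gaussNorm DV u) ^ 2 / 2| ≤
        ω * (gaussNorm DV u) ^ 2 / 2) :
    (∫ u in Uᶜ, exp (F u)) ≤ 4 * exp (-xx - pG / 2) * Z := by
  have hZ0 : 0 ≤ Z := by rw [hZ]; exact integral_nonneg fun u => (exp_pos _).le
  have hr0 : 0 < rG := by
    have : 0 < √(2 * xx) := Real.sqrt_pos.2 (by linarith)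
    have := Real.sqrt_nonneg pG
    linarith
  have hR0 : 0 < rG / ν := by positivity
  rcases Nat.eq_zero_or_pos p with rfl | hp
  · have : Uᶜ = ∅ := by
      rw [Set.compl_empty_iff, hUdef]
      ext u
      simp only [Set.mem_ofPred_eq, Set.mem_univ, iff_true]
      rw [Subsingleton.elim u 0, gaussNorm, map_zero, norm_zero]
      exact hR0.le
    rw [this, Measure.restrict_empty, integral_zero_measure]
    positivity
  haveI : Nonempty (Fin p) := ⟨⟨0, hp⟩⟩
  have hdet : IsUnit DG.det := hDG.det_pos.ne'.isUnit
  have hGt : DGᵀ = DG := (conjTranspose_eq_transpose_of_trivial DG).symm.trans hDG.isHermitian.eq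
  have hVt : DVᵀ = DV := (conjTranspose_eq_transpose_of_trivial DV).symm.trans hDV.isHermitian.eq
  have hpG0 : 0 < pG := by
    have hW : ((DV * DG⁻¹)ᴴ * (DV * DG⁻¹)).PosDef := by
      apply PosDef.conjTranspose_mul_self
      apply Matrix.mulVec_injective_of_isUnit
      rw [Matrix.isUnit_iff_isUnit_det, det_mul]
      exact hDV.det_pos.ne'.isUnit.mul (by rw [det_nonsing_inv]; exact hdet.ringInverse)
    have h := hW.trace_pos
    rw [conjTranspose_eq_transpose_of_trivial, transpose_mul, transpose_nonsing_inv, hGt, hVt] at h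
    have e : ((DV * DV) * (DG * DG)⁻¹).trace = (DG⁻¹ * DV * (DV * DG⁻¹)).trace := by
      rw [Matrix.mul_inv_rev, Matrix.mul_assoc DG⁻¹ DV, Matrix.trace_mul_comm DG⁻¹]
      simp only [Matrix.mul_assoc]
    rw [hpG, e]; exact h
  have hZl : ENNReal.ofReal Z = auxM DG Set.univ := by
    have hfin : auxM DG Set.univ ≠ ⊤ := by
      rw [auxM_univ, aux_lint DG hDG.det_pos.ne']
      exact ENNReal.mul_ne_top ENNReal.ofReal_ne_top (auxC_ne_top p)
    rw [hZ, integral_eq_lintegral_of_nonneg_ae (Filter.Eventually.of_forall fun u => (exp_pos _).le)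
      (by have := aux_gauss_cont DG; fun_prop), ← auxM_univ, ENNReal.ofReal_toReal hfin]
  have hFc : Continuous F := by
    have h1 := aux_gauss_cont DG
    have h2 := aux_gauss_cont DV
    have h3 := hℓsmooth.continuous
    rw [show F = _ from funext hF]
    fun_prop
  -- pointwise bound outside `U`
  have hpt : ∀ u ∈ Uᶜ, rG < gaussNorm DV u ∧
      F u ≤ -gaussNorm DG u ^ 2 / 2 + (gaussNorm DV u ^ 2 / 2 - rG * gaussNorm DV u / 2) := by
    intro u hu
    rw [hUdef] at hu
    have ht : rG / ν < gaussNorm DV u := by simpa using hu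
    have hrR : rG ≤ rG / ν := by rw [le_div_iff₀ hν0]; nlinarith
    refine ⟨hrR.trans_lt ht, ?_⟩
    obtain ⟨t, htd⟩ : ∃ t, t = gaussNorm DV u := ⟨_, rfl⟩
    obtain ⟨R, hRd⟩ : ∃ R, R = rG / ν := ⟨_, rfl⟩
    rw [← htd, ← hRd] at ht
    rw [← hRd] at hR0
    have ht0 : 0 < t := hR0.trans ht
    obtain ⟨c, hc⟩ : ∃ c, c = R / t := ⟨_, rfl⟩
    have hc0 : 0 < c := by rw [hc]; positivity
    have hc1 : c ≤ 1 := by rw [hc, div_le_one ht0]; exact ht.le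
    have hct : c * t = R := by rw [hc]; field_simp
    have hnorm : gaussNorm DV (c • u) = R := by
      rw [gaussNorm, map_smul, norm_smul, Real.norm_of_nonneg hc0.le, ← hct, htd, gaussNorm]
    have hmem : c • u ∈ U := by
      rw [hUdef]; simp only [Set.mem_ofPred_eq]; rw [hnorm, hRd]
    have h1 := (le_abs_self _).trans (hδ _ hmem)
    rw [hnorm, map_smul, smul_eq_mul] at h1
    have h2 := hℓconc.2 (Set.mem_univ 0) (Set.mem_univ u) (sub_nonneg.2 hc1) hc0.le (by ring)
    rw [smul_zero, zero_add, smul_eq_mul, smul_eq_mul] at h2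
    have hνR : ν * R = rG := by rw [hRd]; field_simp
    have h3 : c * (ℓ u - ℓ 0 - fderiv ℝ ℓ 0 u) ≤ c * (-(rG * t / 2)) := by
      have : c * (-(rG * t / 2)) = -(ν * R ^ 2 / 2) := by
        rw [← hνR]; linear_combination (-(ν * R / 2)) * hct
      rw [this]
      nlinarith [mul_le_mul_of_nonneg_right hων (sq_nonneg R)]
    have h4 := le_of_mul_le_mul_left h3 hc0
    rw [hF, ← htd]
    linarith
  have hms : MeasurableSet {u | rG < gaussNorm DV u} :=
    measurableSet_lt measurable_const (aux_gauss_cont DV).measurable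
  have hmU : MeasurableSet Uᶜ := by
    rw [hUdef]
    exact (measurableSet_le (aux_gauss_cont DV).measurable measurable_const).compl
  rw [integral_eq_lintegral_of_nonneg_ae (Filter.Eventually.of_forall fun u => (exp_pos _).le)
    (by fun_prop)]
  refine ENNReal.toReal_le_of_le_ofReal (by positivity) ?_
  rw [ENNReal.ofReal_mul (by positivity), hZl]
  refine le_trans ?_ (aux_main DG DV hDG hDV hLoewner pG hpG hpG0 xx rG hxx hrG)
  have hc1 := aux_gauss_cont DG
  have hc2 := aux_gauss_cont DV
  rw [auxM, setLIntegral_withDensity_eq_setLIntegral_mul _ (by fun_prop) (by fun_prop) hms]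
  calc _ ≤ ∫⁻ u in Uᶜ, ((fun u => ENNReal.ofReal (exp (-gaussNorm DG u ^ 2 / 2))) *
        fun u => ENNReal.ofReal (exp (gaussNorm DV u ^ 2 / 2 - rG * gaussNorm DV u / 2))) u := by
        refine setLIntegral_mono' hmU fun u hu => ?_
        rw [Pi.mul_apply, ← ENNReal.ofReal_mul (exp_pos _).le, ← Real.exp_add]
        exact ENNReal.ofReal_le_ofReal (Real.exp_le_exp.2 (hpt u hu).2)
    _ ≤ _ := lintegral_mono_set fun u hu => (hpt u hu).1
end
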